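/- Existence for β>0 (Theorem 1.1, part (1)). Let β>0 and let V : ℝ² → ℝ be locally integrable and radially symmetric, and assume there are constants C>0 and 0<R₁<R₂ with V(x) ≥ C for a.e. x with R₁<‖x‖<R₂. Assume ∫_{‖x‖≥1} V⁻(x)·‖x‖^{-2β} dx < ∞, and that for some δ>0 one has ∫_{‖x‖≤1} V⁺(x)·‖x‖^{-β-δ} dx < ∞ and ∫_{‖x‖≥1} V⁺(x)·‖x‖^{-β+δ} dx < ∞. Then there exists a locally integrable, radially symmetric ψ : ℝ² → ℝ which is continuously differentiable on ℝ²∖{0} and satisfies: (i) ψ is a weak solution of -Δψ = 4πβ·V·e^{ψ} on ℝ²; (ii) ∫_{ℝ²} |V|·e^{ψ} dx < ∞ and ∫_{ℝ²} V·e^{ψ} dx = 1; (iii) for every smooth radially symmetric ψ₀ : ℝ² → ℝ with ψ₀(x) = 2β·log‖x‖ for all ‖x‖ ≥ 1, one has ∫_{ℝ²∖{0}} ‖∇ψ(x) + ∇ψ₀(x)‖² dx < ∞; (iv) ψ(x)/log‖x‖ → -2β as ‖x‖ → ∞. -/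

import Mathlib

open MeasureTheory Real Filter Bornology Metric
open scoped NNReal

noncomputable section

abbrev R2 : Type := EuclideanSpace ℝ (Fin 2)

/-- The Laplacian of `f : ℝ² → ℝ`, via the second iterated Fréchet derivative. -/
def lap (f : R2 → ℝ) (x : R2) : ℝ :=
  ∑ i : Fin 2, iteratedFDeriv ℝ 2 f x ![EuclideanSpace.single i 1, EuclideanSpace.single i 1]

/-- `ψ` is a weak (distributional) solution of `-Δψ = g` on `ℝ²`:
for every smooth compactly supported test function `φ`, `∫ ψ·Δφ = -∫ g·φ`. -/
def IsWeakSol (ψ g : R2 → ℝ) : Prop :=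
  ∀ φ : R2 → ℝ, ContDiff ℝ (⊤ : ℕ∞) φ → HasCompactSupport φ →
    ∫ x : R2, ψ x * lap φ x = -∫ x : R2, g x * φ x

/-- `f` is radially symmetric. -/
def RadSym (f : R2 → ℝ) : Prop := ∀ x y : R2, ‖x‖ = ‖y‖ → f x = f y

open scoped Topology InnerProductSpace

theorem exists_weakly_convergent_subseq {H : Type*} [NormedAddCommGroup H] [InnerProductSpace ℝ H]
    [CompleteSpace H] [TopologicalSpace.SeparableSpace H] (u : ℕ → H) (B : ℝ)
    (hu : ∀ n, ‖u n‖ ≤ B) :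
    ∃ f : H, ∃ φ : ℕ → ℕ, StrictMono φ ∧
      ∀ g : H, Tendsto (fun n => ⟪g, u (φ n)⟫_ℝ) atTop (𝓝 ⟪g, f⟫_ℝ) := by
  have hc := WeakDual.isSeqCompact_closedBall ℝ H (0 : StrongDual ℝ H) B
  obtain ⟨a, -, φ, hφ, ha⟩ := hc
    (x := fun n => StrongDual.toWeakDual (InnerProductSpace.toDual ℝ H (u n))) (fun n => by
      simpa using hu n)
  refine ⟨(InnerProductSpace.toDual ℝ H).symm (WeakDual.toStrongDual a), φ, hφ, fun g => ?_⟩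
  have h1 := ((WeakBilin.eval_continuous (topDualPairing ℝ H) g).tendsto a).comp ha
  rw [real_inner_comm, InnerProductSpace.toDual_symm_apply]
  refine Tendsto.congr (fun n => ?_) h1
  exact (real_inner_comm _ _)

theorem inner_le_mul_sq_add {H : Type*} [NormedAddCommGroup H] [InnerProductSpace ℝ H]
    {γ : ℝ} (hγ : 0 < γ) (k g : H) : ⟪k, g⟫_ℝ ≤ γ * ‖k‖ ^ 2 + ‖g‖ ^ 2 / (4 * γ) := by
  have h1 := real_inner_le_norm k g
  have h2 : γ * ‖k‖ ^ 2 + ‖g‖ ^ 2 / (4 * γ) - ‖k‖ * ‖g‖ = (2 * γ * ‖k‖ - ‖g‖) ^ 2 / (4 * γ) := by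
    field_simp; ring
  have h3 : 0 ≤ (2 * γ * ‖k‖ - ‖g‖) ^ 2 / (4 * γ) := by positivity
  linarith

theorem integrable_mul_exp_inner {H : Type*} [NormedAddCommGroup H] [InnerProductSpace ℝ H]
    {α : Type*} [MeasurableSpace α] {μ : Measure α} {P : α → ℝ} {K : α → H} {γ : ℝ} (hγ : 0 < γ)
    (hP0 : ∀ x, 0 ≤ P x) (hPm : AEStronglyMeasurable P μ)
    (hK : ∀ g : H, AEStronglyMeasurable (fun x => ⟪K x, g⟫_ℝ) μ)
    (hP : Integrable (fun x => P x * exp (γ * ‖K x‖ ^ 2)) μ) (g : H) :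
    Integrable (fun x => P x * exp ⟪K x, g⟫_ℝ) μ ∧
      ∫ x, P x * exp ⟪K x, g⟫_ℝ ∂μ ≤
        (∫ x, P x * exp (γ * ‖K x‖ ^ 2) ∂μ) * exp (‖g‖ ^ 2 / (4 * γ)) := by
  have hb : ∀ x, P x * exp ⟪K x, g⟫_ℝ ≤ P x * exp (γ * ‖K x‖ ^ 2) * exp (‖g‖ ^ 2 / (4 * γ)) := by
    intro x
    rw [mul_assoc, ← exp_add]
    exact mul_le_mul_of_nonneg_left (exp_le_exp.2 (inner_le_mul_sq_add hγ _ _)) (hP0 x)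
  have hI : Integrable (fun x => P x * exp ⟪K x, g⟫_ℝ) μ := by
    refine (hP.mul_const (exp (‖g‖ ^ 2 / (4 * γ)))).mono'
      (hPm.mul (continuous_exp.comp_aestronglyMeasurable (hK g))) (ae_of_all _ fun x => ?_)
    rw [norm_of_nonneg (mul_nonneg (hP0 x) (exp_pos _).le)]
    exact hb x
  refine ⟨hI, ?_⟩
  rw [← integral_mul_const]
  exact integral_mono hI (hP.mul_const _) hb

theorem integrable_of_tendsto_of_integral_tendsto {α : Type*} [MeasurableSpace α] {μ : Measure α}
    {F : ℕ → α → ℝ} {G : α → ℝ} {L : ℝ} (hF0 : ∀ n x, 0 ≤ F n x)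
    (hF : ∀ n, Integrable (F n) μ) (hG : AEStronglyMeasurable G μ)
    (hlim : ∀ x, Tendsto (fun n => F n x) atTop (𝓝 (G x)))
    (hL : Tendsto (fun n => ∫ x, F n x ∂μ) atTop (𝓝 L)) :
    Integrable G μ ∧ ∫ x, G x ∂μ ≤ L := by
  have hG0 : ∀ x, 0 ≤ G x := fun x => ge_of_tendsto' (hlim x) fun n => hF0 n x
  have hL0 : 0 ≤ L := ge_of_tendsto' hL fun n => integral_nonneg (hF0 n)
  have key : ∫⁻ x, ENNReal.ofReal (G x) ∂μ ≤ ENNReal.ofReal L := by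
    calc ∫⁻ x, ENNReal.ofReal (G x) ∂μ
        = ∫⁻ x, liminf (fun n => ENNReal.ofReal (F n x)) atTop ∂μ := by
          refine lintegral_congr fun x => ?_
          exact (((ENNReal.continuous_ofReal.tendsto _).comp (hlim x)).liminf_eq).symm
      _ ≤ liminf (fun n => ∫⁻ x, ENNReal.ofReal (F n x) ∂μ) atTop :=
          lintegral_liminf_le' fun n => (hF n).1.aemeasurable.ennreal_ofReal
      _ = ENNReal.ofReal L := by
          refine Tendsto.liminf_eq ?_
          refine ((ENNReal.continuous_ofReal.tendsto _).comp hL).congr fun n => ?_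
          exact ofReal_integral_eq_lintegral_ofReal (hF n) (ae_of_all _ (hF0 n))
  have hI : Integrable G μ :=
    (lintegral_ofReal_ne_top_iff_integrable hG (ae_of_all _ hG0)).1
      (key.trans_lt ENNReal.ofReal_lt_top).ne
  refine ⟨hI, ?_⟩
  rw [← ofReal_integral_eq_lintegral_ofReal hI (ae_of_all _ hG0)] at key
  exact (ENNReal.ofReal_le_ofReal_iff hL0).1 key

theorem exists_maximizer {H : Type*} [NormedAddCommGroup H] [InnerProductSpace ℝ H]
    [CompleteSpace H] [TopologicalSpace.SeparableSpace H]
    {α : Type*} [MeasurableSpace α] {μ : Measure α} {P N : α → ℝ} {K : α → H} {b γ : ℝ}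
    (hb : 0 < b) (hbγ : b < γ)
    (hP0 : ∀ x, 0 ≤ P x) (hPm : AEStronglyMeasurable P μ)
    (hN0 : ∀ x, 0 ≤ N x) (hNm : AEStronglyMeasurable N μ)
    (hK : ∀ g : H, AEStronglyMeasurable (fun x => ⟪K x, g⟫_ℝ) μ)
    (hP : Integrable (fun x => P x * exp (γ * ‖K x‖ ^ 2)) μ)
    {f₀ : H} (hf₀ : Integrable (fun x => N x * exp ⟪K x, f₀⟫_ℝ) μ)
    (hpos : 0 < ∫ x, P x * exp ⟪K x, f₀⟫_ℝ ∂μ - ∫ x, N x * exp ⟪K x, f₀⟫_ℝ ∂μ) :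
    ∃ f : H, Integrable (fun x => N x * exp ⟪K x, f⟫_ℝ) μ ∧
      0 < ∫ x, P x * exp ⟪K x, f⟫_ℝ ∂μ - ∫ x, N x * exp ⟪K x, f⟫_ℝ ∂μ ∧
      ∀ g : H, Integrable (fun x => N x * exp ⟪K x, g⟫_ℝ) μ →
        (∫ x, P x * exp ⟪K x, g⟫_ℝ ∂μ - ∫ x, N x * exp ⟪K x, g⟫_ℝ ∂μ)
            * exp (-(‖g‖ ^ 2 / (4 * b))) ≤
          (∫ x, P x * exp ⟪K x, f⟫_ℝ ∂μ - ∫ x, N x * exp ⟪K x, f⟫_ℝ ∂μ)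
            * exp (-(‖f‖ ^ 2 / (4 * b))) := by
  have hγ : 0 < γ := hb.trans hbγ
  set Zp : H → ℝ := fun g => ∫ x, P x * exp ⟪K x, g⟫_ℝ ∂μ with hZp
  set Zn : H → ℝ := fun g => ∫ x, N x * exp ⟪K x, g⟫_ℝ ∂μ with hZn
  set A : ℝ := ∫ x, P x * exp (γ * ‖K x‖ ^ 2) ∂μ with hA
  have hA0 : 0 ≤ A := integral_nonneg fun x => mul_nonneg (hP0 x) (exp_pos _).le
  have hZn0 : ∀ g, 0 ≤ Zn g := fun g => integral_nonneg fun x => mul_nonneg (hN0 x) (exp_pos _).le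
  have hZpA : ∀ g, Zp g ≤ A * exp (‖g‖ ^ 2 / (4 * γ)) := fun g =>
    (integrable_mul_exp_inner hγ hP0 hPm hK hP g).2
  set κ : ℝ := 1 / (4 * b) - 1 / (4 * γ) with hκdef
  have hκ : 0 < κ := by
    rw [hκdef, sub_pos]
    exact one_div_lt_one_div_of_lt (by positivity) (by linarith)
  set Φ : H → ℝ := fun g => (Zp g - Zn g) * exp (-(‖g‖ ^ 2 / (4 * b))) with hΦ
  have hΦA : ∀ g, Φ g ≤ A * exp (-(κ * ‖g‖ ^ 2)) := by
    intro g
    calc Φ g ≤ (A * exp (‖g‖ ^ 2 / (4 * γ))) * exp (-(‖g‖ ^ 2 / (4 * b))) :=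
          mul_le_mul_of_nonneg_right (by linarith [hZpA g, hZn0 g]) (exp_pos _).le
      _ = A * exp (-(κ * ‖g‖ ^ 2)) := by
          rw [mul_assoc, ← exp_add]
          congr 2
          rw [hκdef]; ring
  set S : Set ℝ := Φ '' {g | Integrable (fun x => N x * exp ⟪K x, g⟫_ℝ) μ} with hS
  have hf₀S : Φ f₀ ∈ S := ⟨f₀, hf₀, rfl⟩
  have hbdd : BddAbove S := by
    refine ⟨A, ?_⟩
    rintro _ ⟨g, -, rfl⟩
    refine (hΦA g).trans (mul_le_of_le_one_right hA0 ?_)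
    exact exp_le_one_iff.2 (by nlinarith [sq_nonneg ‖g‖])
  have hS0 : 0 < sSup S := (mul_pos hpos (exp_pos _)).trans_le (le_csSup hbdd hf₀S)
  obtain ⟨u, -, hut, huS⟩ := exists_seq_tendsto_sSup ⟨_, hf₀S⟩ hbdd
  obtain ⟨n₀, hn₀⟩ := eventually_atTop.1 (hut.eventually (lt_mem_nhds (half_lt_self hS0)))
  choose v hvI hv using fun n => huS (n + n₀)
  have hvt : Tendsto (fun n => Φ (v n)) atTop (𝓝 (sSup S)) := by
    simp only [hv]
    exact (tendsto_add_atTop_iff_nat n₀).2 hut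
  obtain ⟨B, hB⟩ : ∃ B, ∀ n, ‖v n‖ ≤ B := by
    refine ⟨√(2 * A / (sSup S * κ)), fun n => le_sqrt_of_sq_le ?_⟩
    have h1 : sSup S / 2 < A * exp (-(κ * ‖v n‖ ^ 2)) :=
      ((hn₀ (n + n₀) (by omega)).trans_eq (hv n).symm).trans_le (hΦA _)
    have h2 := add_one_le_exp (κ * ‖v n‖ ^ 2)
    rw [exp_neg, ← div_eq_mul_inv, lt_div_iff₀ (exp_pos _)] at h1
    rw [le_div_iff₀ (by positivity)]
    nlinarith
  obtain ⟨f, φ, hφ, hf⟩ := exists_weakly_convergent_subseq v B hB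
  obtain ⟨ρ, -, χ, hχ, hρ⟩ := isCompact_Icc.tendsto_subseq (x := fun n => ‖v (φ n)‖)
    (s := Set.Icc 0 B) fun n => ⟨norm_nonneg _, hB _⟩
  set w : ℕ → H := fun n => v (φ (χ n)) with hw
  have hwf : ∀ g : H, Tendsto (fun n => ⟪g, w n⟫_ℝ) atTop (𝓝 ⟪g, f⟫_ℝ) := fun g =>
    (hf g).comp hχ.tendsto_atTop
  have hwρ : Tendsto (fun n => ‖w n‖) atTop (𝓝 ρ) := hρ
  have hwΦ : Tendsto (fun n => Φ (w n)) atTop (𝓝 (sSup S)) :=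
    hvt.comp (hφ.comp hχ).tendsto_atTop
  have hfρ : ‖f‖ ≤ ρ := by
    have h1 : ⟪f, f⟫_ℝ ≤ ‖f‖ * ρ :=
      le_of_tendsto_of_tendsto' (hwf f) (hwρ.const_mul ‖f‖) fun n => real_inner_le_norm _ _
    rw [real_inner_self_eq_norm_sq] at h1
    rcases (norm_nonneg f).eq_or_lt with h | h
    · rw [← h]; exact ge_of_tendsto' hwρ fun n => norm_nonneg _
    · nlinarith
  have hZpt : Tendsto (fun n => Zp (w n)) atTop (𝓝 (Zp f)) := by
    refine tendsto_integral_of_dominated_convergence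
      (fun x => P x * exp (γ * ‖K x‖ ^ 2) * exp (B ^ 2 / (4 * γ)))
      (fun n => (integrable_mul_exp_inner hγ hP0 hPm hK hP (w n)).1.1) (hP.mul_const _)
      (fun n => ae_of_all _ fun x => ?_) (ae_of_all _ fun x => ?_)
    · rw [norm_of_nonneg (mul_nonneg (hP0 x) (exp_pos _).le), mul_assoc, ← exp_add]
      refine mul_le_mul_of_nonneg_left (exp_le_exp.2 ?_) (hP0 x)
      refine (inner_le_mul_sq_add hγ _ _).trans ?_
      have : ‖w n‖ ≤ B := hB _
      gcongr
    · exact ((continuous_exp.tendsto _).comp (hwf (K x))).const_mul _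
  have hZnt : Tendsto (fun n => Zn (w n)) atTop
      (𝓝 (Zp f - sSup S * exp (ρ ^ 2 / (4 * b)))) := by
    have h1 : Tendsto (fun n => exp (‖w n‖ ^ 2 / (4 * b))) atTop (𝓝 (exp (ρ ^ 2 / (4 * b)))) :=
      (continuous_exp.tendsto _).comp ((hwρ.pow 2).div_const _)
    refine (hZpt.sub (hwΦ.mul h1)).congr fun n => ?_
    simp only [hΦ]
    rw [mul_assoc, ← exp_add, neg_add_cancel, exp_zero]
    ring
  obtain ⟨hfI, hfL⟩ := integrable_of_tendsto_of_integral_tendsto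
    (F := fun n x => N x * exp ⟪K x, w n⟫_ℝ) (G := fun x => N x * exp ⟪K x, f⟫_ℝ)
    (fun n x => mul_nonneg (hN0 x) (exp_pos _).le) (fun n => hvI _)
    (hNm.mul (continuous_exp.comp_aestronglyMeasurable (hK f)))
    (fun x => ((continuous_exp.tendsto _).comp (hwf (K x))).const_mul _) hZnt
  have h1 : sSup S * exp (‖f‖ ^ 2 / (4 * b)) ≤ Zp f - Zn f := by
    have : sSup S * exp (‖f‖ ^ 2 / (4 * b)) ≤ sSup S * exp (ρ ^ 2 / (4 * b)) := by gcongr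
    linarith
  refine ⟨f, hfI, (mul_pos hS0 (exp_pos _)).trans_le h1, fun g hg => ?_⟩
  calc Φ g ≤ sSup S := le_csSup hbdd ⟨g, hg, rfl⟩
    _ = sSup S * exp (‖f‖ ^ 2 / (4 * b)) * exp (-(‖f‖ ^ 2 / (4 * b))) := by
        rw [mul_assoc, ← exp_add, add_neg_cancel, exp_zero, mul_one]
    _ ≤ _ := mul_le_mul_of_nonneg_right h1 (exp_pos _).le

theorem euler_lagrange_of_maximizer {H : Type*} [NormedAddCommGroup H] [InnerProductSpace ℝ H]
    {α : Type*} [MeasurableSpace α] {μ : Measure α} {P N : α → ℝ} {K : α → H} {b : ℝ}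
    (hb : 0 < b)
    (hP0 : ∀ x, 0 ≤ P x) (hN0 : ∀ x, 0 ≤ N x)
    (hK : ∀ g : H, AEStronglyMeasurable (fun x => ⟪K x, g⟫_ℝ) μ)
    (hNm : AEStronglyMeasurable N μ)
    (hP : ∀ g, Integrable (fun x => P x * exp ⟪K x, g⟫_ℝ) μ)
    {f : H} (hN : Integrable (fun x => N x * exp ⟪K x, f⟫_ℝ) μ)
    (hmax : ∀ g : H, Integrable (fun x => N x * exp ⟪K x, g⟫_ℝ) μ →
        (∫ x, P x * exp ⟪K x, g⟫_ℝ ∂μ - ∫ x, N x * exp ⟪K x, g⟫_ℝ ∂μ)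
            * exp (-(‖g‖ ^ 2 / (4 * b))) ≤
          (∫ x, P x * exp ⟪K x, f⟫_ℝ ∂μ - ∫ x, N x * exp ⟪K x, f⟫_ℝ ∂μ)
            * exp (-(‖f‖ ^ 2 / (4 * b))))
    {g : H} {C : ℝ} (hg : ∀ x, |⟪K x, g⟫_ℝ| ≤ C) :
    (∫ x, (P x - N x) * exp ⟪K x, f⟫_ℝ ∂μ) * ⟪f, g⟫_ℝ =
      2 * b * ∫ x, ⟪K x, g⟫_ℝ * ((P x - N x) * exp ⟪K x, f⟫_ℝ) ∂μ := by
  set Z : ℝ → ℝ := fun ε => ∫ x, (P x - N x) * exp ⟪K x, f + ε • g⟫_ℝ ∂μ with hZ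
  have hexp : ∀ (ε : ℝ) x, exp ⟪K x, f + ε • g⟫_ℝ = exp ⟪K x, f⟫_ℝ * exp (ε * ⟪K x, g⟫_ℝ) := by
    intro ε x
    rw [inner_add_right, real_inner_smul_right, exp_add]
  have hNε : ∀ ε : ℝ, Integrable (fun x => N x * exp ⟪K x, f + ε • g⟫_ℝ) μ := by
    intro ε
    refine (hN.mul_const (exp (|ε| * C))).mono'
      (hNm.mul (continuous_exp.comp_aestronglyMeasurable (hK _))) (ae_of_all _ fun x => ?_)
    rw [norm_of_nonneg (mul_nonneg (hN0 x) (exp_pos _).le), hexp, ← mul_assoc]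
    refine mul_le_mul_of_nonneg_left (exp_le_exp.2 ?_) (mul_nonneg (hN0 x) (exp_pos _).le)
    calc ε * ⟪K x, g⟫_ℝ ≤ |ε| * |⟪K x, g⟫_ℝ| := by rw [← abs_mul]; exact le_abs_self _
      _ ≤ |ε| * C := mul_le_mul_of_nonneg_left (hg x) (abs_nonneg _)
  have hZeq : ∀ ε : ℝ, Z ε = ∫ x, P x * exp ⟪K x, f + ε • g⟫_ℝ ∂μ
      - ∫ x, N x * exp ⟪K x, f + ε • g⟫_ℝ ∂μ := by
    intro ε
    rw [← integral_sub (hP _) (hNε ε)]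
    simp only [hZ, sub_mul]
  have hZ0 : Z 0 = ∫ x, (P x - N x) * exp ⟪K x, f⟫_ℝ ∂μ := by simp [hZ]
  have hZint : ∀ ε : ℝ, Integrable (fun x => (P x - N x) * exp ⟪K x, f + ε • g⟫_ℝ) μ := by
    intro ε
    simp only [sub_mul]
    exact (hP _).sub (hNε ε)
  have hZd : HasDerivAt Z (∫ x, ⟪K x, g⟫_ℝ * ((P x - N x) * exp ⟪K x, f⟫_ℝ) ∂μ) 0 := by
    have := (hasDerivAt_integral_of_dominated_loc_of_deriv_le (μ := μ) (x₀ := (0 : ℝ))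
      (s := ball 0 1)
      (F := fun ε x => (P x - N x) * exp ⟪K x, f + ε • g⟫_ℝ)
      (F' := fun ε x => ⟪K x, g⟫_ℝ * ((P x - N x) * exp ⟪K x, f + ε • g⟫_ℝ))
      (bound := fun x => C * exp C * (P x * exp ⟪K x, f⟫_ℝ + N x * exp ⟪K x, f⟫_ℝ))
      (ball_mem_nhds _ one_pos) (Eventually.of_forall fun ε => (hZint ε).1) (hZint 0)
      ((hK g).mul (hZint 0).1) (ae_of_all _ fun x ε hε => ?_)
      (((hP f).add hN).const_mul _) (ae_of_all _ fun x ε _ => ?_)).2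
    · simpa using this
    · rw [norm_mul, norm_mul, hexp, norm_of_nonneg (mul_pos (exp_pos _) (exp_pos _)).le,
        Real.norm_eq_abs, Real.norm_eq_abs]
      have h1 : |P x - N x| ≤ P x + N x := abs_le.2 ⟨by linarith [hP0 x], by linarith [hN0 x]⟩
      have h2 : exp (ε * ⟪K x, g⟫_ℝ) ≤ exp C := by
        refine exp_le_exp.2 ?_
        have h3 : |ε| ≤ 1 := by
          rw [mem_ball_zero_iff] at hε
          exact hε.le
        calc ε * ⟪K x, g⟫_ℝ ≤ |ε| * |⟪K x, g⟫_ℝ| := by rw [← abs_mul]; exact le_abs_self _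
          _ ≤ 1 * |⟪K x, g⟫_ℝ| := mul_le_mul_of_nonneg_right h3 (abs_nonneg _)
          _ ≤ C := by rw [one_mul]; exact hg x
      have hC : 0 ≤ C := (abs_nonneg _).trans (hg x)
      calc |⟪K x, g⟫_ℝ| * (|P x - N x| * (exp ⟪K x, f⟫_ℝ * exp (ε * ⟪K x, g⟫_ℝ)))
          ≤ C * ((P x + N x) * (exp ⟪K x, f⟫_ℝ * exp C)) := by
            have := hP0 x
            have := hN0 x
            gcongr
            exact hg x
        _ = _ := by ring
    · have h1 : HasDerivAt (fun ε : ℝ => ⟪K x, f + ε • g⟫_ℝ) ⟪K x, g⟫_ℝ ε := by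
        simp only [inner_add_right, real_inner_smul_right]
        simpa using ((hasDerivAt_id ε).mul_const ⟪K x, g⟫_ℝ).const_add ⟪K x, f⟫_ℝ
      exact (h1.exp.const_mul (P x - N x)).congr_deriv (by ring)
  have hEd : HasDerivAt (fun ε : ℝ => exp (-(‖f + ε • g‖ ^ 2 / (4 * b))))
      (exp (-(‖f‖ ^ 2 / (4 * b))) * (-(2 * ⟪f, g⟫_ℝ / (4 * b)))) 0 := by
    have h1 : HasDerivAt (fun ε : ℝ => f + ε • g) g 0 := by
      simpa using ((hasDerivAt_id (0 : ℝ)).smul_const g).const_add f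
    have h2 := ((h1.norm_sq.div_const (4 * b)).neg).exp
    simpa using h2
  have hloc : IsLocalMax (fun ε : ℝ => Z ε * exp (-(‖f + ε • g‖ ^ 2 / (4 * b)))) 0 := by
    refine Eventually.of_forall fun ε => ?_
    have := hmax (f + ε • g) (hNε ε)
    rw [← hZeq] at this
    have h0 := hZeq 0
    rw [zero_smul, add_zero] at h0
    simp only [zero_smul, add_zero]
    rwa [h0]
  have h := hloc.hasDerivAt_eq_zero (hZd.mul hEd)
  rw [zero_smul, add_zero, hZ0] at h
  generalize (∫ x, (P x - N x) * exp ⟪K x, f⟫_ℝ ∂μ) = Z₀ at h ⊢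
  generalize (∫ x, ⟪K x, g⟫_ℝ * ((P x - N x) * exp ⟪K x, f⟫_ℝ) ∂μ) = I at h ⊢
  generalize ⟪f, g⟫_ℝ = s at h ⊢
  have h3 : (I - Z₀ * s / (2 * b)) * exp (-(‖f‖ ^ 2 / (4 * b))) = 0 := by
    rw [← h]; ring
  have h4 := (mul_eq_zero.1 h3).resolve_right (exp_pos _).ne'
  rw [sub_eq_zero, eq_div_iff (by positivity)] at h4
  linarith

/-- The Riesz representative in `L²(ℝ)` of the functional `f ↦ ∫ s in 0..t, f s`. -/
def primitiveVec (t : ℝ) : Lp ℝ 2 (volume : Measure ℝ) :=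
  indicatorConstLp 2 (s := Set.Ioc 0 t) measurableSet_Ioc measure_Ioc_lt_top.ne 1 -
    indicatorConstLp 2 (s := Set.Ioc t 0) measurableSet_Ioc measure_Ioc_lt_top.ne 1

theorem inner_primitiveVec (t : ℝ) (f : Lp ℝ 2 (volume : Measure ℝ)) :
    ⟪primitiveVec t, f⟫_ℝ = ∫ s in (0)..t, f s := by
  rw [primitiveVec, inner_sub_left, L2.inner_indicatorConstLp_one, L2.inner_indicatorConstLp_one,
    intervalIntegral]

theorem inner_primitiveVec_primitiveVec (t s : ℝ) :
    ⟪primitiveVec t, primitiveVec s⟫_ℝ = max t 0 - (max (t - s) 0 - max (-s) 0) := by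
  simp only [primitiveVec, inner_sub_left, inner_sub_right,
    L2.inner_indicatorConstLp_indicatorConstLp, Set.Ioc_inter_Ioc, Measure.real, Real.volume_Ioc]
  simp only [ENNReal.toReal_ofReal', max_self, min_self, sub_zero, zero_sub, real_inner_self_eq_norm_sq,
    norm_one, one_pow, smul_eq_mul, mul_one]
  have h1 : max (min t 0 - max 0 s) 0 = 0 :=
    max_eq_right (by linarith [min_le_right t 0, le_max_left 0 s])
  have h2 : max (min 0 s - max t 0) 0 = 0 :=
    max_eq_right (by linarith [min_le_left 0 s, le_max_right t 0])
  rw [h1, h2]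
  rcases le_total t s with h | h
  · rw [min_eq_left h, max_eq_right h, max_eq_right (sub_nonpos.2 h)]
    ring
  · rw [min_eq_right h, max_eq_left h, max_eq_left (sub_nonneg.2 h)]
    have e1 := max_zero_sub_eq_self s
    have e2 := max_zero_sub_eq_self t
    linarith

theorem norm_primitiveVec_sq (t : ℝ) : ‖primitiveVec t‖ ^ 2 = |t| := by
  rw [← real_inner_self_eq_norm_sq, inner_primitiveVec_primitiveVec, sub_self, max_self,
    zero_sub, sub_neg_eq_add]
  rcases le_total t 0 with h | h
  · rw [max_eq_right h, max_eq_left (neg_nonneg.2 h), abs_of_nonpos h, zero_add]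
  · rw [max_eq_left h, max_eq_right (neg_nonpos.2 h), abs_of_nonneg h, add_zero]

theorem abs_max_sub_sub_max_neg_le (t s : ℝ) : |max (t - s) 0 - max (-s) 0| ≤ |t| := by
  have := abs_max_sub_max_le_abs (t - s) (-s) 0
  simpa using this

theorem continuous_inner_primitiveVec (f : Lp ℝ 2 (volume : Measure ℝ)) :
    Continuous fun t => ⟪primitiveVec t, f⟫_ℝ := by
  simp only [inner_primitiveVec]
  exact intervalIntegral.continuous_primitive
    (fun a b => (((Lp.memLp f).locallyIntegrable (by norm_num)).integrableOn_isCompact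
      isCompact_uIcc).intervalIntegrable) 0

theorem abs_inner_primitiveVec_primitiveVec_le (t s : ℝ) :
    |⟪primitiveVec t, primitiveVec s⟫_ℝ| ≤ |t| := by
  have h := abs_le.1 (abs_max_sub_sub_max_neg_le t s)
  rw [inner_primitiveVec_primitiveVec, abs_le]
  rcases le_total t 0 with h1 | h1
  · rw [max_eq_right h1, abs_of_nonpos h1] at *
    constructor <;> linarith
  · have h2 : max (-s) 0 ≤ max (t - s) 0 := max_le_max_right _ (by linarith)
    rw [max_eq_left h1, abs_of_nonneg h1] at *
    constructor <;> linarith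

/-- The tent function supported on `[a, b]`, with slopes `±1`. -/
def tent (a b t : ℝ) : ℝ := max (t - a) 0 + max (t - b) 0 - 2 * max (t - (a + b) / 2) 0

theorem tent_nonneg (a b t : ℝ) : 0 ≤ tent a b t := by
  unfold tent
  rcases le_total t ((a + b) / 2) with h | h
  · rw [max_eq_right (by linarith : t - (a + b) / 2 ≤ 0)]
    linarith [le_max_right (t - a) 0, le_max_right (t - b) 0]
  · rw [max_eq_left (by linarith : 0 ≤ t - (a + b) / 2)]
    have h1 := le_max_left (t - a) 0
    have h2 := le_max_left (t - b) 0
    linarith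

theorem tent_pos {a b t : ℝ} (ha : a < t) (hb : t < b) : 0 < tent a b t := by
  unfold tent
  rw [max_eq_left (by linarith : 0 ≤ t - a), max_eq_right (by linarith : t - b ≤ 0)]
  rcases le_total t ((a + b) / 2) with h | h
  · rw [max_eq_right (by linarith : t - (a + b) / 2 ≤ 0)]; linarith
  · rw [max_eq_left (by linarith : 0 ≤ t - (a + b) / 2)]; linarith

theorem tent_eq_zero {a b t : ℝ} (hab : a < b) (h : ¬(a < t ∧ t < b)) : tent a b t = 0 := by
  unfold tent
  rcases le_or_gt t a with h1 | h1
  · rw [max_eq_right (by linarith : t - a ≤ 0), max_eq_right (by linarith : t - b ≤ 0),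
      max_eq_right (by linarith : t - (a + b) / 2 ≤ 0)]
    ring
  · have h2 : b ≤ t := not_lt.1 fun h2 => h ⟨h1, h2⟩
    rw [max_eq_left (by linarith : 0 ≤ t - a), max_eq_left (by linarith : 0 ≤ t - b),
      max_eq_left (by linarith : 0 ≤ t - (a + b) / 2)]
    ring

theorem tent_le {a b : ℝ} (hab : a < b) (t : ℝ) : tent a b t ≤ b - a := by
  by_cases h : a < t ∧ t < b
  · unfold tent
    rw [max_eq_left (by linarith : 0 ≤ t - a), max_eq_right (by linarith : t - b ≤ 0)]
    linarith [le_max_right (t - (a + b) / 2) 0]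
  · rw [tent_eq_zero hab h]; linarith

theorem continuous_tent (a b : ℝ) : Continuous (tent a b) := by
  unfold tent; fun_prop

theorem inner_primitiveVec_tent (a b t : ℝ) :
    ⟪primitiveVec t,
      (2 : ℝ) • primitiveVec ((a + b) / 2) - primitiveVec a - primitiveVec b⟫_ℝ =
      tent a b t - tent a b 0 := by
  simp only [inner_sub_right, real_inner_smul_right, inner_primitiveVec_primitiveVec, tent,
    zero_sub]
  ring

theorem exists_positive_mass {α : Type*} [MeasurableSpace α] {μ : Measure α} {P N T : α → ℝ}
    (hT : AEMeasurable T μ) (hP0 : ∀ x, 0 ≤ P x)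
    (hPI : ∀ f, Integrable (fun x => P x * exp ⟪primitiveVec (T x), f⟫_ℝ) μ)
    (hNI : Integrable N μ) {a b : ℝ} (hab : a < b)
    (hP : ∀ᵐ x ∂μ, a < T x → T x < b → 0 < P x)
    (hN : ∀ᵐ x ∂μ, a < T x → T x < b → N x = 0)
    (hμ : μ {x | a < T x ∧ T x < b} ≠ 0) :
    ∃ f₀, Integrable (fun x => N x * exp ⟪primitiveVec (T x), f₀⟫_ℝ) μ ∧
      0 < ∫ x, P x * exp ⟪primitiveVec (T x), f₀⟫_ℝ ∂μ
        - ∫ x, N x * exp ⟪primitiveVec (T x), f₀⟫_ℝ ∂μ := by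
  have hPint : Integrable P μ := by simpa using hPI 0
  have hGm : AEStronglyMeasurable (fun x => tent a b (T x)) μ :=
    ((continuous_tent a b).measurable.comp_aemeasurable hT).aestronglyMeasurable
  have hPG : Integrable (fun x => P x * tent a b (T x)) μ := by
    refine (hPint.mul_const (b - a)).mono' (hPint.1.mul hGm) (ae_of_all _ fun x => ?_)
    rw [norm_of_nonneg (mul_nonneg (hP0 x) (tent_nonneg a b _))]
    exact mul_le_mul_of_nonneg_left (tent_le hab _) (hP0 x)
  have hpos : 0 < ∫ x, P x * tent a b (T x) ∂μ := by
    rw [integral_pos_iff_support_of_nonneg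
      (fun x => mul_nonneg (hP0 x) (tent_nonneg a b _)) hPG]
    refine lt_of_lt_of_le (pos_iff_ne_zero.2 hμ) (measure_mono_ae ?_)
    filter_upwards [hP] with x hx hxT
    exact (mul_pos (hx hxT.1 hxT.2) (tent_pos hxT.1 hxT.2)).ne'
  obtain ⟨M, hM⟩ := exists_gt ((∫ x, N x ∂μ) / ∫ x, P x * tent a b (T x) ∂μ)
  rw [div_lt_iff₀ hpos] at hM
  set f₀ := M • ((2 : ℝ) • primitiveVec ((a + b) / 2) - primitiveVec a - primitiveVec b) with hf₀
  have hinner : ∀ t, exp ⟪primitiveVec t, f₀⟫_ℝ =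
      exp (M * tent a b t) * exp (-(M * tent a b 0)) := by
    intro t
    rw [hf₀, real_inner_smul_right, inner_primitiveVec_tent, ← exp_add]
    ring_nf
  have hNe : (fun x => N x * exp ⟪primitiveVec (T x), f₀⟫_ℝ) =ᵐ[μ]
      fun x => N x * exp (-(M * tent a b 0)) := by
    filter_upwards [hN] with x hx
    by_cases h : a < T x ∧ T x < b
    · rw [hx h.1 h.2, zero_mul, zero_mul]
    · rw [hinner, tent_eq_zero hab h, mul_zero, exp_zero, one_mul]
  refine ⟨f₀, (hNI.mul_const _).congr hNe.symm, ?_⟩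
  rw [integral_congr_ae hNe, integral_mul_const]
  have h1 : (M * ∫ x, P x * tent a b (T x) ∂μ) * exp (-(M * tent a b 0)) ≤
      ∫ x, P x * exp ⟪primitiveVec (T x), f₀⟫_ℝ ∂μ := by
    rw [← integral_const_mul, ← integral_mul_const]
    refine integral_mono ((hPG.const_mul _).mul_const _) (hPI f₀) fun x => ?_
    simp only [hinner]
    rw [← mul_assoc (P x)]
    refine mul_le_mul_of_nonneg_right ?_ (exp_pos _).le
    have h2 := add_one_le_exp (M * tent a b (T x))
    nlinarith [hP0 x]
  have h3 := mul_lt_mul_of_pos_right hM (exp_pos (-(M * tent a b 0)))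
  linarith

theorem exists_normalized_profile {α : Type*} [MeasurableSpace α] {μ : Measure α} {V T : α → ℝ}
    {β δ : ℝ} (hβ : 0 < β) (hδ : 0 < δ)
    (hV : AEStronglyMeasurable V μ) (hT : AEMeasurable T μ)
    (hVp : Integrable (fun x => max (V x) 0 * exp (-β * T x + δ * |T x|)) μ)
    (hVn : Integrable (fun x => max (-V x) 0 * exp (-(2 * β) * max (T x) 0)) μ)
    {a b : ℝ} (hab : a < b) (hVpos : ∀ᵐ x ∂μ, a < T x → T x < b → 0 < V x)
    (hμ : μ {x | a < T x ∧ T x < b} ≠ 0) :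
    ∃ (f : Lp ℝ 2 (volume : Measure ℝ)) (c : ℝ) (W : ℝ → ℝ),
      (∀ t, W t = c - 2 * β * max t 0 + ∫ s in (0)..t, f s) ∧
      Integrable (fun x => V x * exp (W (T x))) μ ∧
      ∫ x, V x * exp (W (T x)) ∂μ = 1 ∧
      ∀ t, W t =
        c - 2 * β * ∫ x, (max (t - T x) 0 - max (-T x) 0) * (V x * exp (W (T x))) ∂μ := by
  set E : α → ℝ := fun x => exp (-(2 * β) * max (T x) 0) with hE
  have hEm : AEStronglyMeasurable E μ :=
    (measurable_exp.comp_aemeasurable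
      ((hT.max aemeasurable_const).const_mul _)).aestronglyMeasurable
  set P : α → ℝ := fun x => max (V x) 0 * E x with hP
  set N : α → ℝ := fun x => max (-V x) 0 * E x with hN
  have hP0 : ∀ x, 0 ≤ P x := fun x => mul_nonneg (le_max_right _ _) (exp_pos _).le
  have hN0 : ∀ x, 0 ≤ N x := fun x => mul_nonneg (le_max_right _ _) (exp_pos _).le
  have hPN : ∀ x, P x - N x = V x * E x := by
    intro x
    simp only [hP, hN, ← sub_mul]
    rw [max_comm, max_comm (-V x)]
    have := max_zero_sub_max_neg_zero_eq_self (V x)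
    rw [max_comm, max_comm (-V x)] at this
    rw [this]
  have hPm : AEStronglyMeasurable P μ :=
    (hV.aemeasurable.max aemeasurable_const).aestronglyMeasurable.mul hEm
  have hKm : ∀ g, AEStronglyMeasurable (fun x => ⟪primitiveVec (T x), g⟫_ℝ) μ := fun g =>
    ((continuous_inner_primitiveVec g).measurable.comp_aemeasurable hT).aestronglyMeasurable
  have hPγ : Integrable (fun x => P x * exp ((β + δ) * ‖primitiveVec (T x)‖ ^ 2)) μ := by
    refine hVp.congr (ae_of_all _ fun x => ?_)
    simp only [hP, hE, norm_primitiveVec_sq]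
    rw [mul_assoc, ← exp_add]
    congr 2
    rcases le_total (T x) 0 with h | h
    · rw [max_eq_right h, abs_of_nonpos h]; ring
    · rw [max_eq_left h, abs_of_nonneg h]; ring
  have hPI := fun g => (integrable_mul_exp_inner (by positivity) hP0 hPm hKm hPγ g).1
  obtain ⟨f₀, hf₀, hf₀pos⟩ := exists_positive_mass hT hP0 hPI hVn hab
    (hVpos.mono fun x hx h1 h2 => mul_pos (lt_max_of_lt_left (hx h1 h2)) (exp_pos _))
    (hVpos.mono fun x hx h1 h2 => by
      simp only [hN]
      rw [max_eq_right (by linarith [hx h1 h2]), zero_mul]) hμ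
  have : Fact ((2 : ENNReal) ≠ ⊤) := ⟨by simp⟩
  obtain ⟨f, hfN, hfpos, hmax⟩ := exists_maximizer hβ (by linarith : β < β + δ) hP0 hPm hN0
    hVn.1 hKm hPγ hf₀ hf₀pos
  have hEL := fun g C hg => euler_lagrange_of_maximizer hβ hP0 hN0 hKm hVn.1 hPI hfN hmax
    (g := g) (C := C) hg
  set Z : ℝ := ∫ x, (P x - N x) * exp ⟪primitiveVec (T x), f⟫_ℝ ∂μ with hZ
  have hZI : Integrable (fun x => (P x - N x) * exp ⟪primitiveVec (T x), f⟫_ℝ) μ := by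
    simp only [sub_mul]
    exact (hPI f).sub hfN
  have hZpos : 0 < Z := by
    rw [hZ]
    simp only [sub_mul]
    rwa [integral_sub (hPI f) hfN]
  set W : ℝ → ℝ := fun t => -log Z - 2 * β * max t 0 + ∫ s in (0)..t, f s with hW
  have hq : ∀ x, V x * exp (W (T x)) =
      Z⁻¹ * ((P x - N x) * exp ⟪primitiveVec (T x), f⟫_ℝ) := by
    intro x
    rw [hPN, inner_primitiveVec, hW]
    simp only [exp_add, sub_eq_add_neg, exp_neg, exp_log hZpos, hE]
    rw [neg_mul, exp_neg]
    ring
  have hqI : Integrable (fun x => V x * exp (W (T x))) μ := by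
    simp only [hq]
    exact hZI.const_mul _
  have hq1 : ∫ x, V x * exp (W (T x)) ∂μ = 1 := by
    simp only [hq]
    rw [integral_const_mul, ← hZ, inv_mul_cancel₀ hZpos.ne']
  refine ⟨f, -log Z, W, fun t => rfl, hqI, hq1, fun t => ?_⟩
  have h1 := hEL (primitiveVec t) |t| fun x => by
    rw [real_inner_comm]
    exact abs_inner_primitiveVec_primitiveVec_le t (T x)
  have h2 : ∫ x, ⟪primitiveVec (T x), primitiveVec t⟫_ℝ * (V x * exp (W (T x))) ∂μ =
      max t 0 - ∫ x, (max (t - T x) 0 - max (-T x) 0) * (V x * exp (W (T x))) ∂μ := by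
    simp only [real_inner_comm (primitiveVec t), inner_primitiveVec_primitiveVec, sub_mul (max t 0)]
    rw [integral_sub (hqI.const_mul _), integral_const_mul, hq1, mul_one]
    refine hqI.bdd_mul (c := |t|) ?_ (ae_of_all _ fun x => abs_max_sub_sub_max_neg_le t (T x))
    exact (((aemeasurable_const.sub hT).max aemeasurable_const).sub
      (hT.neg.max aemeasurable_const)).aestronglyMeasurable
  have h3 : ⟪f, primitiveVec t⟫_ℝ = 2 * β *
      ∫ x, ⟪primitiveVec (T x), primitiveVec t⟫_ℝ * (V x * exp (W (T x))) ∂μ := by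
    simp only [hq, mul_left_comm _ Z⁻¹]
    rw [integral_const_mul, mul_left_comm, ← h1, inv_mul_cancel_left₀ hZpos.ne']
  rw [h2, real_inner_comm, inner_primitiveVec] at h3
  simp only [hW]
  linarith

section LogPotential

variable {α : Type*} [MeasurableSpace α] {μ : Measure α} {T q : α → ℝ}

theorem aestronglyMeasurable_max_sub_sub_max_neg (hT : AEMeasurable T μ) (t : ℝ) :
    AEStronglyMeasurable (fun x => max (t - T x) 0 - max (-T x) 0) μ :=
  (((aemeasurable_const.sub hT).max aemeasurable_const).sub
    (hT.neg.max aemeasurable_const)).aestronglyMeasurable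

theorem integrable_max_sub_sub_max_neg_mul (hT : AEMeasurable T μ) (hq : Integrable q μ) (t : ℝ) :
    Integrable (fun x => (max (t - T x) 0 - max (-T x) 0) * q x) μ :=
  hq.bdd_mul (c := |t|) (aestronglyMeasurable_max_sub_sub_max_neg hT t)
    (ae_of_all _ fun x => abs_max_sub_sub_max_neg_le t (T x))

theorem hasDerivAt_max_sub {s t : ℝ} (h : s ≠ t) :
    HasDerivAt (fun t => max (t - s) 0) (if s ≤ t then 1 else 0) t := by
  rcases h.lt_or_gt with h | h
  · rw [if_pos h.le]
    refine ((hasDerivAt_id t).sub_const s).congr_of_eventuallyEq ?_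
    filter_upwards [lt_mem_nhds h] with u hu
    exact max_eq_left (by simpa using hu.le)
  · rw [if_neg h.not_ge]
    refine (hasDerivAt_const t (0 : ℝ)).congr_of_eventuallyEq ?_
    filter_upwards [gt_mem_nhds h] with u hu
    exact max_eq_right (by linarith)

theorem hasDerivAt_logPotential (hT : Measurable T) (hq : Integrable q μ)
    (h0 : ∀ t, ∀ᵐ x ∂μ, T x ≠ t) (t : ℝ) :
    HasDerivAt (fun t => ∫ x, (max (t - T x) 0 - max (-T x) 0) * q x ∂μ)
      (∫ x, (if T x ≤ t then 1 else 0) * q x ∂μ) t := by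
  have hm : AEStronglyMeasurable (fun x => (if T x ≤ t then 1 else 0 : ℝ)) μ :=
    (Measurable.ite (hT measurableSet_Iic) measurable_const measurable_const).aestronglyMeasurable
  refine (hasDerivAt_integral_of_dominated_loc_of_lip (μ := μ) (s := Set.univ)
    (F := fun t x => (max (t - T x) 0 - max (-T x) 0) * q x)
    (F' := fun x => (if T x ≤ t then 1 else 0) * q x) (bound := fun x => |q x|) univ_mem
    (Eventually.of_forall fun t => (integrable_max_sub_sub_max_neg_mul hT.aemeasurable hq t).1)
    (integrable_max_sub_sub_max_neg_mul hT.aemeasurable hq t) (hm.mul hq.1)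
    (ae_of_all _ fun x => ?_) hq.abs ?_).2
  · refine LipschitzOnWith.of_dist_le_mul fun u _ v _ => ?_
    rw [Real.dist_eq, Real.dist_eq, ← sub_mul, abs_mul, Real.coe_nnabs, abs_abs, mul_comm]
    refine mul_le_mul_of_nonneg_left ?_ (abs_nonneg _)
    have := abs_max_sub_max_le_abs (u - T x) (v - T x) 0
    simpa using this
  · filter_upwards [h0 t] with x hx
    exact ((hasDerivAt_max_sub hx).sub_const _).mul_const _

theorem continuous_integral_ite_mul (hT : Measurable T) (hq : Integrable q μ)
    (h0 : ∀ t, ∀ᵐ x ∂μ, T x ≠ t) :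
    Continuous fun t => ∫ x, (if T x ≤ t then 1 else 0) * q x ∂μ := by
  refine continuous_iff_continuousAt.2 fun t => ?_
  refine continuousAt_of_dominated (bound := fun x => |q x|) (Eventually.of_forall fun u => ?_)
    (Eventually.of_forall fun u => ae_of_all _ fun x => ?_) hq.abs ?_
  · exact (Measurable.ite (hT measurableSet_Iic) measurable_const
      measurable_const).aestronglyMeasurable.mul hq.1
  · rw [norm_mul, Real.norm_eq_abs (q x)]
    refine mul_le_of_le_one_left (abs_nonneg _) ?_
    split_ifs <;> simp
  · filter_upwards [h0 t] with x hx
    refine ContinuousAt.mul ?_ continuousAt_const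
    refine (continuousAt_const (y := if T x ≤ t then (1 : ℝ) else 0)).congr ?_
    rcases hx.lt_or_gt with h | h
    · filter_upwards [lt_mem_nhds h] with u hu
      rw [if_pos h.le, if_pos hu.le]
    · filter_upwards [gt_mem_nhds h] with u hu
      rw [if_neg h.not_ge, if_neg hu.not_ge]

theorem tendsto_logPotential_div (hT : AEMeasurable T μ) (hq : Integrable q μ) :
    Tendsto (fun t => (∫ x, (max (t - T x) 0 - max (-T x) 0) * q x ∂μ) / t) atTop
      (𝓝 (∫ x, q x ∂μ)) := by
  simp only [← integral_div]
  refine tendsto_integral_filter_of_dominated_convergence (fun x => |q x|)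
    (Eventually.of_forall fun t => ((integrable_max_sub_sub_max_neg_mul hT hq t).div_const t).1)
    ?_ hq.abs (ae_of_all _ fun x => ?_)
  · filter_upwards [eventually_gt_atTop 0] with t ht
    refine ae_of_all _ fun x => ?_
    rw [norm_div, norm_mul, Real.norm_eq_abs, Real.norm_eq_abs, Real.norm_eq_abs,
      div_le_iff₀ (abs_pos.2 ht.ne'), mul_comm]
    exact mul_le_mul_of_nonneg_left (abs_max_sub_sub_max_neg_le t (T x)) (abs_nonneg _)
  · have h1 : Tendsto (fun t : ℝ => (1 - (T x + max (-T x) 0) / t) * q x) atTop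
        (𝓝 ((1 - 0) * q x)) :=
      ((tendsto_const_nhds.div_atTop tendsto_id).const_sub 1).mul_const _
    rw [sub_zero, one_mul] at h1
    refine h1.congr' ?_
    filter_upwards [eventually_gt_atTop 0, eventually_ge_atTop (T x)] with t ht htx
    rw [max_eq_left (sub_nonneg.2 htx)]
    field_simp
    ring

end LogPotential

theorem deriv_ae_eq_of_eq_primitive {f : Lp ℝ 2 (volume : Measure ℝ)} {c m : ℝ} {W W' : ℝ → ℝ}
    (hW : ∀ t, W t = c - m * max t 0 + ∫ s in (0)..t, f s)
    (hW' : ∀ t, HasDerivAt W (W' t) t) :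
    ∀ᵐ t, W' t + m * (if 0 ≤ t then 1 else 0) = f t := by
  have hf : LocallyIntegrable f volume := (Lp.memLp f).locallyIntegrable (by norm_num)
  filter_upwards [LocallyIntegrable.ae_hasDerivAt_integral hf, Measure.ae_ne volume (0 : ℝ)] with t ht ht0
  have h1 : HasDerivAt W (-(m * (if 0 ≤ t then 1 else 0)) + f t) t := by
    have h2 := hasDerivAt_max_sub ht0.symm
    simp only [sub_zero] at h2
    have := ((h2.const_mul m).const_sub c).add (ht 0)
    exact this.congr_of_eventuallyEq (Eventually.of_forall hW)
  rw [(hW' t).unique h1]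
  ring

theorem integrable_sq_deriv_of_eq_primitive {f : Lp ℝ 2 (volume : Measure ℝ)} {c m : ℝ}
    {W W' : ℝ → ℝ} (hW : ∀ t, W t = c - m * max t 0 + ∫ s in (0)..t, f s)
    (hW' : ∀ t, HasDerivAt W (W' t) t) :
    Integrable fun t => (W' t + m * (if 0 ≤ t then 1 else 0)) ^ 2 := by
  refine (Lp.memLp f).integrable_sq.congr ?_
  filter_upwards [deriv_ae_eq_of_eq_primitive hW hW'] with t ht
  rw [ht]

theorem smul_homeomorphUnitSphereProd {E : Type*} [NormedAddCommGroup E] [NormedSpace ℝ E]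
    (x : ({(0 : E)}ᶜ : Set E)) :
    (homeomorphUnitSphereProd E x).2.1 • (homeomorphUnitSphereProd E x).1.1 = x.1 := by
  simp [smul_smul, mul_inv_cancel₀ (norm_ne_zero_iff.2 x.2)]

section Polar

variable {E : Type*} [NormedAddCommGroup E] [NormedSpace ℝ E] [FiniteDimensional ℝ E]
  [Nontrivial E] [MeasurableSpace E] [BorelSpace E] {μ : Measure E} [μ.IsAddHaarMeasure]

theorem integral_volumeIoiPow (n : ℕ) (f : ℝ → ℝ) :
    ∫ r, f r ∂(Measure.volumeIoiPow n) = ∫ r in Set.Ioi (0 : ℝ), r ^ n * f r := by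
  simp only [Measure.volumeIoiPow, ENNReal.ofReal]
  rw [integral_withDensity_eq_integral_smul,
    integral_subtype_comap measurableSet_Ioi fun a ↦ Real.toNNReal (a ^ n) • f a,
    setIntegral_congr_fun measurableSet_Ioi fun x hx ↦ ?_]
  · rw [NNReal.smul_def, Real.coe_toNNReal _ (pow_nonneg (Set.mem_Ioi.1 hx).le _), smul_eq_mul]
  · exact (measurable_subtype_coe.pow_const _).real_toNNReal

theorem integrable_polar {f : E → ℝ} (hf : Integrable f μ) :
    Integrable (fun p : sphere (0 : E) 1 × Set.Ioi (0 : ℝ) => f (p.2.1 • p.1.1))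
      (μ.toSphere.prod (.volumeIoiPow (Module.finrank ℝ E - 1))) := by
  rw [← μ.measurePreserving_homeomorphUnitSphereProd.integrable_comp_emb
    (Homeomorph.measurableEmbedding _)]
  simp only [Function.comp_def, smul_homeomorphUnitSphereProd]
  rw [← restrict_compl_singleton (μ := μ) 0, ← IntegrableOn,
    integrableOn_iff_comap_subtypeVal (by measurability)] at hf
  exact hf

theorem integral_polar (f : E → ℝ) :
    ∫ x, f x ∂μ = ∫ p : sphere (0 : E) 1 × Set.Ioi (0 : ℝ), f (p.2.1 • p.1.1)
      ∂(μ.toSphere.prod (.volumeIoiPow (Module.finrank ℝ E - 1))) := by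
  rw [← μ.measurePreserving_homeomorphUnitSphereProd.integral_comp
    (Homeomorph.measurableEmbedding _)]
  simp only [smul_homeomorphUnitSphereProd]
  rw [integral_subtype_comap (measurableSet_singleton _).compl f, restrict_compl_singleton]

theorem integral_eq_integral_sphere_integral_Ioi {f : E → ℝ} (hf : Integrable f μ) :
    ∫ x, f x ∂μ = ∫ ω : sphere (0 : E) 1, (∫ r in Set.Ioi (0 : ℝ),
      r ^ (Module.finrank ℝ E - 1) * f (r • ω.1)) ∂μ.toSphere := by
  rw [integral_polar, integral_prod _ (integrable_polar hf)]
  exact integral_congr_ae (ae_of_all _ fun ω =>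
    integral_volumeIoiPow _ fun r => f (r • ω.1))

theorem integral_radial_mul_integral_sphere {q φ : E → ℝ}
    (hq : ∀ x y, ‖x‖ = ‖y‖ → q x = q y) (hqφ : Integrable (fun x => q x * φ x) μ) :
    ∫ x, q x * (∫ ω : sphere (0 : E) 1, φ (‖x‖ • ω.1) ∂μ.toSphere) ∂μ =
      μ.toSphere.real Set.univ * ∫ x, q x * φ x ∂μ := by
  obtain ⟨e, he⟩ := NormedSpace.sphere_nonempty (E := E) (x := 0) (r := 1) |>.2 zero_le_one
  have hn : ∀ (ω : sphere (0 : E) 1) (r : Set.Ioi (0 : ℝ)), ‖r.1 • ω.1‖ = r.1 := fun ω r => by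
    rw [norm_smul, norm_eq_of_mem_sphere, mul_one, Real.norm_of_nonneg (Set.mem_Ioi.1 r.2).le]
  have hqr : ∀ (ω : sphere (0 : E) 1) (r : Set.Ioi (0 : ℝ)), q (r.1 • ω.1) = q (r.1 • e) :=
    fun ω r => hq _ _ ((hn ω r).trans (hn ⟨e, he⟩ r).symm)
  rw [integral_polar (fun x => q x * ∫ ω : sphere (0 : E) 1, φ (‖x‖ • ω.1) ∂μ.toSphere),
    integral_polar (fun x => q x * φ x), integral_prod_symm _ (integrable_polar hqφ)]
  simp only [hn, hqr, integral_const_mul]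
  exact integral_fun_snd (fun r : Set.Ioi (0 : ℝ) =>
    q (r.1 • e) * ∫ ω : sphere (0 : E) 1, φ (r.1 • ω.1) ∂μ.toSphere)

end Polar

theorem hasFDerivAt_log_norm {E : Type*} [NormedAddCommGroup E] [InnerProductSpace ℝ E] {x : E}
    (hx : x ≠ 0) : HasFDerivAt (fun y : E => log ‖y‖) ((‖x‖ ^ 2)⁻¹ • innerSL ℝ x) x := by
  have h0 : ‖x‖ ^ 2 ≠ 0 := pow_ne_zero 2 (norm_ne_zero_iff.2 hx)
  have h := ((hasStrictFDerivAt_norm_sq x).hasFDerivAt.log h0).const_mul (1 / 2)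
  refine (h.congr_of_eventuallyEq (Eventually.of_forall fun y => ?_)).congr_fderiv ?_
  · simp [log_pow]
  · ext v
    simp
    ring

theorem lap_eq_sum_lineDeriv {φ : R2 → ℝ} (hφ : ContDiff ℝ (⊤ : ℕ∞) φ) (x : R2) :
    lap φ x = ∑ i : Fin 2, lineDeriv ℝ (fun y => fderiv ℝ φ y (EuclideanSpace.single i 1)) x
      (EuclideanSpace.single i 1) := by
  refine Finset.sum_congr rfl fun i _ => ?_
  have h : DifferentiableAt ℝ (fderiv ℝ φ) x :=
    (hφ.fderiv_right (m := 1) (by norm_cast)).differentiable one_ne_zero x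
  have h1 := (h.hasFDerivAt.clm_apply (hasFDerivAt_const (EuclideanSpace.single i (1 : ℝ)) x))
  rw [(h1.hasLineDerivAt _).lineDeriv, iteratedFDeriv_two_apply]
  simp

theorem continuous_lap {φ : R2 → ℝ} (hφ : ContDiff ℝ (⊤ : ℕ∞) φ) : Continuous (lap φ) := by
  refine continuous_finsetSum _ fun i _ => ?_
  simp only [iteratedFDeriv_two_apply]
  have h : Continuous (fderiv ℝ (fderiv ℝ φ)) :=
    (hφ.fderiv_right (m := 1) (by norm_cast)).continuous_fderiv one_ne_zero
  exact (h.clm_apply continuous_const).clm_apply continuous_const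

theorem hasCompactSupport_lap {φ : R2 → ℝ} (hφ : HasCompactSupport φ) :
    HasCompactSupport (lap φ) := by
  refine (hφ.fderiv ℝ).fderiv ℝ |>.mono fun x hx => ?_
  contrapose! hx
  simp only [Function.mem_support, not_not] at hx ⊢
  simp [lap, iteratedFDeriv_two_apply, hx]

theorem integral_mul_lap {φ L : R2 → ℝ} (hφ : ContDiff ℝ (⊤ : ℕ∞) φ) (hφc : HasCompactSupport φ)
    {K : ℝ≥0} (hL : LipschitzWith K L) {L' : R2 → R2 →L[ℝ] ℝ}
    (hL' : ∀ᵐ x, HasFDerivAt L (L' x) x) :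
    ∫ x, L x * lap φ x =
      -∑ i : Fin 2, ∫ x, L' x (EuclideanSpace.single i 1) *
        fderiv ℝ φ x (EuclideanSpace.single i 1) := by
  have hg : ∀ v : R2, ContDiff ℝ (⊤ : ℕ∞) fun y => fderiv ℝ φ y v := fun v =>
    (hφ.fderiv_right (by norm_cast)).clm_apply contDiff_const
  simp only [lap_eq_sum_lineDeriv hφ, Finset.mul_sum]
  rw [integral_finsetSum, ← Finset.sum_neg_distrib]
  · refine Finset.sum_congr rfl fun i _ => ?_
    obtain ⟨D, hD⟩ := (hg (EuclideanSpace.single i 1)).lipschitzWith_of_hasCompactSupport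
      (hφc.fderiv_apply ℝ _) (by simp)
    have h := hL.integral_lineDeriv_mul_eq (μ := volume) hD (hφc.fderiv_apply ℝ _)
      (EuclideanSpace.single i 1)
    simp only [lineDeriv_neg, neg_mul, integral_neg] at h
    simp only [mul_comm (L _)]
    rw [← neg_eq_iff_eq_neg, ← h]
    refine integral_congr_ae ?_
    filter_upwards [hL'] with x hx
    rw [(hx.hasLineDerivAt _).lineDeriv]
  · intro i _
    have h1 : ∀ x, lineDeriv ℝ (fun y => fderiv ℝ φ y (EuclideanSpace.single i 1)) x
        (EuclideanSpace.single i 1) = fderiv ℝ (fun y => fderiv ℝ φ y (EuclideanSpace.single i 1)) x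
        (EuclideanSpace.single i 1) := fun x =>
      ((hg _).differentiable (by simp) x).lineDeriv_eq_fderiv
    simp only [h1]
    refine (hL.continuous.mul
      (((hg _).continuous_fderiv (by simp)).clm_apply continuous_const)).integrable_of_hasCompactSupport
      (((hφc.fderiv_apply ℝ _).fderiv_apply ℝ _).mul_left)

theorem integral_lap {φ : R2 → ℝ} (hφ : ContDiff ℝ (⊤ : ℕ∞) φ) (hφc : HasCompactSupport φ) :
    ∫ x, lap φ x = 0 := by
  have h := integral_mul_lap hφ hφc (LipschitzWith.const (1 : ℝ)) (L' := fun _ => 0)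
    (ae_of_all _ fun x => hasFDerivAt_const _ _)
  simpa using h

theorem lipschitzWith_log_max_norm {E : Type*} [NormedAddCommGroup E] {a : ℝ} (ha : 0 < a) :
    LipschitzWith (Real.toNNReal a⁻¹) fun x : E => log (max ‖x‖ a) := by
  have key : ∀ u v : ℝ, a ≤ u → u ≤ v → |log u - log v| ≤ a⁻¹ * |u - v| := fun u v hu huv => by
    have hu0 : 0 < u := ha.trans_le hu
    rw [abs_sub_comm, abs_sub_comm u, abs_of_nonneg (sub_nonneg.2 (log_le_log hu0 huv)),
      abs_of_nonneg (sub_nonneg.2 huv), ← log_div (hu0.trans_le huv).ne' hu0.ne']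
    calc log (v / u) ≤ v / u - 1 := log_le_sub_one_of_pos (div_pos (hu0.trans_le huv) hu0)
      _ = u⁻¹ * (v - u) := by field_simp
      _ ≤ a⁻¹ * (v - u) :=
        mul_le_mul_of_nonneg_right (inv_anti₀ ha hu) (sub_nonneg.2 huv)
  refine LipschitzWith.of_dist_le_mul fun x y => ?_
  rw [Real.dist_eq, Real.coe_toNNReal _ (inv_pos.2 ha).le, dist_eq_norm]
  have h1 : |max ‖x‖ a - max ‖y‖ a| ≤ ‖x - y‖ :=
    (abs_max_sub_max_le_abs _ _ _).trans (abs_norm_sub_norm_le x y)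
  refine le_trans ?_ (mul_le_mul_of_nonneg_left h1 (inv_pos.2 ha).le)
  rcases le_total (max ‖x‖ a) (max ‖y‖ a) with h | h
  · exact key _ _ (le_max_right _ _) h
  · rw [abs_sub_comm, abs_sub_comm (max ‖x‖ a)]
    exact key _ _ (le_max_right _ _) h

theorem ae_norm_ne (r : ℝ) : ∀ᵐ x : R2, ‖x‖ ≠ r := by
  have h := Measure.addHaar_sphere (volume : Measure R2) 0 r
  filter_upwards [measure_eq_zero_iff_ae_notMem.1 h] with x hx
  simpa using hx

theorem hasFDerivAt_log_max_norm {E : Type*} [NormedAddCommGroup E] [InnerProductSpace ℝ E]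
    {a : ℝ} (ha : 0 < a) {x : E} (hx : ‖x‖ ≠ a) :
    HasFDerivAt (fun y : E => log (max ‖y‖ a))
      ((if a < ‖x‖ then (‖x‖ ^ 2)⁻¹ else 0) • innerSL ℝ x) x := by
  rcases hx.lt_or_gt with h | h
  · rw [if_neg h.not_gt, zero_smul]
    refine (hasFDerivAt_const (log a) x).congr_of_eventuallyEq ?_
    filter_upwards [continuous_norm.continuousAt.eventually_lt_const h] with y hy
    rw [max_eq_right hy.le]
  · rw [if_pos h]
    refine (hasFDerivAt_log_norm (norm_pos_iff.1 (ha.trans h))).congr_of_eventuallyEq ?_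
    filter_upwards [continuous_norm.continuousAt.eventually_const_lt h] with y hy
    rw [max_eq_left hy.le]

theorem integral_log_max_norm_mul_lap {φ : R2 → ℝ} (hφ : ContDiff ℝ (⊤ : ℕ∞) φ)
    (hφc : HasCompactSupport φ) {a : ℝ} (ha : 0 < a) :
    ∫ x, log (max ‖x‖ a) * lap φ x =
      ∫ ω : sphere (0 : R2) 1, φ (a • ω.1) ∂(volume : Measure R2).toSphere := by
  have hφ1 : ContDiff ℝ 1 φ := hφ.of_le (by norm_cast)
  have hc : Continuous fun x : R2 => fderiv ℝ φ x := hφ1.continuous_fderiv one_ne_zero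
  have hm : Continuous fun x : R2 => ((max ‖x‖ a) ^ 2)⁻¹ :=
    ((continuous_norm.max continuous_const).pow 2).inv₀ fun x =>
      (pow_pos (ha.trans_le (le_max_right _ _)) 2).ne'
  have hms : MeasurableSet {x : R2 | a < ‖x‖} := measurableSet_lt measurable_const measurable_norm
  have hint : ∀ g : R2 → R2, Continuous g → Integrable fun x : R2 =>
      (if a < ‖x‖ then (‖x‖ ^ 2)⁻¹ else 0) * fderiv ℝ φ x (g x) := fun g hg => by
    have h1 : Integrable fun x : R2 => ((max ‖x‖ a) ^ 2)⁻¹ * fderiv ℝ φ x (g x) := by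
      refine (hm.mul (hc.clm_apply hg)).integrable_of_hasCompactSupport ?_
      refine (hφc.fderiv ℝ).mono fun x hx => ?_
      contrapose! hx
      simp only [Function.mem_support, not_not] at hx ⊢
      simp [hx]
    refine (h1.indicator hms).congr (ae_of_all _ fun x => ?_)
    by_cases hx : a < ‖x‖
    · simp [hx, hx.le]
    · simp [hx]
  rw [integral_mul_lap hφ hφc (lipschitzWith_log_max_norm ha)
    ((ae_norm_ne a).mono fun x hx => hasFDerivAt_log_max_norm ha hx)]
  have hsum : ∑ i : Fin 2, ∫ x : R2, ((if a < ‖x‖ then (‖x‖ ^ 2)⁻¹ else 0) • innerSL ℝ x)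
      (EuclideanSpace.single i 1) * fderiv ℝ φ x (EuclideanSpace.single i 1) =
      ∫ x : R2, (if a < ‖x‖ then (‖x‖ ^ 2)⁻¹ else 0) * fderiv ℝ φ x x := by
    have hx : ∀ x : R2, fderiv ℝ φ x x =
        ∑ i : Fin 2, fderiv ℝ φ x (x i • EuclideanSpace.single i 1) := fun x => by
      have h := congrArg (fderiv ℝ φ x) ((EuclideanSpace.basisFun (Fin 2) ℝ).sum_repr x)
      rw [map_sum] at h
      simpa using h.symm
    rw [← integral_finsetSum]
    · refine integral_congr_ae (ae_of_all _ fun x => ?_)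
      simp only [hx x, Finset.mul_sum]
      refine Finset.sum_congr rfl fun i _ => ?_
      generalize (if a < ‖x‖ then (‖x‖ ^ 2)⁻¹ else 0) = k
      simp [EuclideanSpace.inner_single_right]
      ring
    · intro i _
      refine (hint (fun x => x i • EuclideanSpace.single i 1) (by fun_prop)).congr
        (ae_of_all _ fun x => ?_)
      beta_reduce
      generalize (if a < ‖x‖ then (‖x‖ ^ 2)⁻¹ else 0) = k
      simp [EuclideanSpace.inner_single_right]
      ring
  rw [hsum, integral_eq_integral_sphere_integral_Ioi (hint (fun x => x) continuous_id), ← integral_neg]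
  refine integral_congr_ae (ae_of_all _ fun ω => ?_)
  have hω : ‖ω.1‖ = 1 := norm_eq_of_mem_sphere ω
  have h1 : ∀ r ∈ Set.Ioi (0 : ℝ), r ^ (Module.finrank ℝ R2 - 1) *
      ((if a < ‖r • ω.1‖ then (‖r • ω.1‖ ^ 2)⁻¹ else 0) * fderiv ℝ φ (r • ω.1) (r • ω.1)) =
      (Set.Ioi a).indicator (deriv fun r : ℝ => φ (r • ω.1)) r := fun r hr => by
    have hr0 : (0 : ℝ) < r := hr
    have hd : HasDerivAt (fun r : ℝ => φ (r • ω.1)) (fderiv ℝ φ (r • ω.1) ω.1) r := by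
      have h2 := ((hφ1.differentiable one_ne_zero (r • ω.1)).hasFDerivAt).comp_hasDerivAt r
        ((hasDerivAt_id r).smul_const ω.1)
      simp only [one_smul] at h2
      exact h2
    rw [norm_smul, hω, mul_one, Real.norm_of_nonneg hr0.le]
    by_cases har : a < r
    · simp [har, hd.deriv]
      field_simp
    · simp [har]
  beta_reduce
  rw [setIntegral_congr_fun measurableSet_Ioi h1, setIntegral_indicator measurableSet_Ioi,
    Set.inter_eq_right.2 (Set.Ioi_subset_Ioi ha.le), HasCompactSupport.integral_Ioi_deriv_eq,
    neg_neg]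
  · exact hφ1.comp (contDiff_id.smul contDiff_const)
  · exact hφc.comp_isClosedEmbedding
      (isClosedEmbedding_smul_left (norm_ne_zero_iff.1 (hω.trans_ne one_ne_zero)))

theorem locallyIntegrable_log_norm : LocallyIntegrable fun x : R2 => log ‖x‖ := by
  refine locallyIntegrable_iff.2 fun K hK => ?_
  obtain ⟨r, hr⟩ := hK.isBounded.subset_ball 0
  refine IntegrableOn.mono_set ?_ hr
  rw [integrableOn_fun_norm_addHaar]
  have h : Continuous fun y : ℝ => y ^ (Module.finrank ℝ R2 - 1) • log y := by
    simpa using continuous_mul_log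
  exact (h.integrableOn_Icc (a := 0) (b := r)).mono_set Set.Ioo_subset_Icc_self

theorem toSphere_volume_real_univ : (volume : Measure R2).toSphere.real Set.univ = 2 * π := by
  rw [Measure.toSphere_real_apply_univ, Measure.real, EuclideanSpace.volume_ball_fin_two]
  simp [pi_pos.le]

theorem max_log_sub_log {u v : ℝ} (hu : 0 < u) (hv : 0 < v) :
    max (log u - log v) 0 = log (max u v) - log v := by
  rcases le_total u v with h | h
  · rw [max_eq_right h, sub_self, max_eq_right (sub_nonpos.2 (log_le_log hu h))]
  · rw [max_eq_left h, max_eq_left (sub_nonneg.2 (log_le_log hv h))]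

theorem integral_max_log_sub_mul_lap {φ : R2 → ℝ} (hφ : ContDiff ℝ (⊤ : ℕ∞) φ)
    (hφc : HasCompactSupport φ) {a : ℝ} (ha : 0 < a) (k : ℝ) :
    ∫ x, (max (log ‖x‖ - log a) 0 - k) * lap φ x =
      ∫ ω : sphere (0 : R2) 1, φ (a • ω.1) ∂(volume : Measure R2).toSphere := by
  rw [← integral_log_max_norm_mul_lap hφ hφc ha]
  have h1 : Integrable fun x : R2 => log (max ‖x‖ a) * lap φ x :=
    ((lipschitzWith_log_max_norm ha).continuous.mul
      (continuous_lap hφ)).integrable_of_hasCompactSupport (hasCompactSupport_lap hφc).mul_left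
  have h2 : Integrable (lap φ) :=
    (continuous_lap hφ).integrable_of_hasCompactSupport (hasCompactSupport_lap hφc)
  calc ∫ x, (max (log ‖x‖ - log a) 0 - k) * lap φ x
      = ∫ x, (log (max ‖x‖ a) * lap φ x - (log a + k) * lap φ x) := by
        refine integral_congr_ae ?_
        filter_upwards [ae_norm_ne 0] with x hx
        rw [max_log_sub_log (lt_of_le_of_ne (norm_nonneg x) hx.symm) ha]
        ring
    _ = _ := by
        rw [integral_sub h1 (h2.const_mul _), integral_const_mul, integral_lap hφ hφc, mul_zero,
          sub_zero]

theorem integral_logPotential_mul_lap {q φ : R2 → ℝ} (hq : Integrable q) (hqr : RadSym q)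
    (hφ : ContDiff ℝ (⊤ : ℕ∞) φ) (hφc : HasCompactSupport φ) :
    ∫ x, (∫ y, (max (log ‖x‖ - log ‖y‖) 0 - max (-log ‖y‖) 0) * q y) * lap φ x =
      2 * π * ∫ x, q x * φ x := by
  have hl : Integrable fun x => log ‖x‖ * lap φ x :=
    (locallyIntegrable_log_norm.integrable_smul_right_of_hasCompactSupport
      (continuous_lap hφ) (hasCompactSupport_lap hφc))
  have hmeas : Measurable fun p : R2 × R2 =>
      max (log ‖p.1‖ - log ‖p.2‖) 0 - max (-log ‖p.2‖) 0 := by fun_prop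
  have hprod : Integrable (fun p : R2 × R2 =>
      (max (log ‖p.1‖ - log ‖p.2‖) 0 - max (-log ‖p.2‖) 0) * q p.2 * lap φ p.1)
      (volume.prod volume) := by
    refine (hl.mul_prod hq).mono ?_ (ae_of_all _ fun p => ?_)
    · exact (hmeas.aestronglyMeasurable.mul hq.1.comp_snd).mul
        (continuous_lap hφ).aestronglyMeasurable.comp_fst
    · rw [norm_mul, norm_mul, norm_mul, norm_mul, mul_right_comm]
      gcongr
      exact abs_max_sub_sub_max_neg_le _ _
  have hφq : Integrable fun x => q x * φ x := by
    obtain ⟨M, hM⟩ := hφc.exists_bound_of_continuous hφ.continuous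
    exact hq.mul_bdd hφ.continuous.aestronglyMeasurable (ae_of_all _ hM)
  simp only [← integral_mul_const]
  rw [integral_integral_swap hprod, ← toSphere_volume_real_univ,
    ← integral_radial_mul_integral_sphere hqr hφq]
  refine integral_congr_ae ?_
  filter_upwards [ae_norm_ne 0] with y hy
  rw [← integral_max_log_sub_mul_lap hφ hφc (lt_of_le_of_ne (norm_nonneg y) hy.symm)
    (max (-log ‖y‖) 0), ← integral_const_mul]
  refine integral_congr_ae (ae_of_all _ fun x => ?_)
  ring

theorem isWeakSol_of_eq_logPotential {ψ q : R2 → ℝ} {c β : ℝ} (hq : Integrable q)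
    (hqr : RadSym q) (hψ : ∀ x, ψ x =
      c - 2 * β * ∫ y, (max (log ‖x‖ - log ‖y‖) 0 - max (-log ‖y‖) 0) * q y)
    (hψi : LocallyIntegrable fun x : R2 =>
      ∫ y, (max (log ‖x‖ - log ‖y‖) 0 - max (-log ‖y‖) 0) * q y) :
    IsWeakSol ψ (fun x => 4 * π * β * q x) := by
  intro φ hφ hφc
  have h2 : Integrable (lap φ) :=
    (continuous_lap hφ).integrable_of_hasCompactSupport (hasCompactSupport_lap hφc)
  have h1 := hψi.integrable_smul_right_of_hasCompactSupport
      (continuous_lap hφ) (hasCompactSupport_lap hφc)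
  simp only [smul_eq_mul] at h1
  calc ∫ x, ψ x * lap φ x = ∫ x, (c * lap φ x - 2 * β *
        ((∫ y, (max (log ‖x‖ - log ‖y‖) 0 - max (-log ‖y‖) 0) * q y) * lap φ x)) := by
        refine integral_congr_ae (ae_of_all _ fun x => ?_)
        simp only [hψ x]
        ring
    _ = -∫ x, 4 * π * β * q x * φ x := by
        rw [integral_sub (h2.const_mul _) (h1.const_mul _), integral_const_mul,
          integral_const_mul, integral_lap hφ hφc, integral_logPotential_mul_lap hq hqr hφ hφc]
        simp only [mul_assoc, integral_const_mul]
        ring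

theorem locallyIntegrable_logPotential {W : ℝ → ℝ} (hW : Continuous W) {M : ℝ}
    (hM : ∀ t, |W t| ≤ M * |t|) : LocallyIntegrable fun x : R2 => W (log ‖x‖) := by
  refine (locallyIntegrable_log_norm.smul M).mono ?_ (ae_of_all _ fun x => ?_)
  · exact (hW.measurable.comp (by fun_prop : Measurable fun x : R2 => log ‖x‖)).aestronglyMeasurable
  · simp only [Pi.smul_apply, smul_eq_mul, norm_mul, Real.norm_eq_abs]
    exact (hM _).trans (mul_le_mul_of_nonneg_right (le_abs_self _) (abs_nonneg _))

section Radial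

variable {E : Type*} [NormedAddCommGroup E] [InnerProductSpace ℝ E]

theorem contDiffOn_comp_log_norm {W : ℝ → ℝ} (hW : ContDiff ℝ 1 W) :
    ContDiffOn ℝ 1 (fun x : E => W (log ‖x‖)) {(0 : E)}ᶜ := fun _ hx =>
  (hW.contDiffAt.comp _ ((contDiffAt_norm ℝ hx).log (norm_ne_zero_iff.2 hx))).contDiffWithinAt

theorem hasGradientAt_comp_log_norm [CompleteSpace E] {W : ℝ → ℝ} {w : ℝ} {x : E} (hx : x ≠ 0)
    (hW : HasDerivAt W w (log ‖x‖)) :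
    HasGradientAt (fun y : E => W (log ‖y‖)) ((w / ‖x‖ ^ 2) • x) x := by
  rw [hasGradientAt_iff_hasFDerivAt]
  refine (hW.comp_hasFDerivAt x (hasFDerivAt_log_norm hx)).congr_fderiv ?_
  ext v
  simp
  ring

end Radial

theorem integrable_comp_log_norm_div_sq {g : ℝ → ℝ} (hg : Integrable g) :
    Integrable fun x : R2 => g (log ‖x‖) / ‖x‖ ^ 2 := by
  refine (integrable_fun_norm_addHaar (E := R2) volume (f := fun r => g (log r) / r ^ 2)).2 ?_
  have h := integrableOn_image_iff_integrableOn_abs_deriv_smul (s := Set.univ) (f := exp)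
    (f' := exp) MeasurableSet.univ (fun x _ => (hasDerivAt_exp x).hasDerivWithinAt)
    exp_injective.injOn
    (fun r => r ^ (Module.finrank ℝ R2 - 1) • (g (log r) / r ^ 2))
  rw [Set.image_univ, range_exp] at h
  refine h.2 (integrableOn_univ.2 (hg.congr (ae_of_all _ fun t => ?_)))
  have := (exp_pos t).ne'
  simp
  field_simp

theorem integrableOn_norm_sq_gradient_add {W W' : ℝ → ℝ} {β : ℝ} (hW : ∀ t, HasDerivAt W (W' t) t)
    (hW'c : Continuous W') (hG : Integrable fun t => (W' t + 2 * β * (if 0 ≤ t then 1 else 0)) ^ 2)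
    {ψ₀ : R2 → ℝ} (hψ₀ : ContDiff ℝ (⊤ : ℕ∞) ψ₀)
    (hψ₀l : ∀ x : R2, 1 ≤ ‖x‖ → ψ₀ x = 2 * β * log ‖x‖) :
    IntegrableOn (fun x : R2 => ‖gradient (fun x => W (log ‖x‖)) x + gradient ψ₀ x‖ ^ 2)
      {(0 : R2)}ᶜ := by
  have hc0 : Continuous (gradient ψ₀) :=
    (InnerProductSpace.toDual ℝ R2).symm.continuous.comp (hψ₀.continuous_fderiv (by simp))
  obtain ⟨M, hM⟩ := (isCompact_closedBall (0 : R2) 1).exists_bound_of_continuousOn hc0.continuousOn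
  have hgr : ∀ x : R2, x ≠ 0 → gradient (fun x => W (log ‖x‖)) x =
      (W' (log ‖x‖) / ‖x‖ ^ 2) • x := fun x hx =>
    (hasGradientAt_comp_log_norm hx (hW _)).gradient
  have hgr0 : ∀ x : R2, 1 < ‖x‖ → gradient ψ₀ x = (2 * β / ‖x‖ ^ 2) • x := fun x hx => by
    have h1 := hasGradientAt_comp_log_norm (norm_pos_iff.1 (one_pos.trans hx))
      ((hasDerivAt_id (log ‖x‖)).const_mul (2 * β))
    rw [mul_one] at h1
    refine (h1.congr_of_eventuallyEq ?_).gradient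
    filter_upwards [continuous_norm.continuousAt.eventually_const_lt hx] with y hy
    exact hψ₀l y hy.le
  have hnorm : ∀ (k : ℝ) (x : R2), x ≠ 0 → ‖(k / ‖x‖ ^ 2) • x‖ ^ 2 = k ^ 2 / ‖x‖ ^ 2 :=
    fun k x hx => by
      have := norm_ne_zero_iff.2 hx
      rw [norm_smul, mul_pow, norm_div, norm_pow, norm_norm, Real.norm_eq_abs, div_pow, sq_abs]
      field_simp
  have hI := integrable_comp_log_norm_div_sq hG
  have hB : Integrable ((closedBall (0 : R2) 1).indicator fun _ => M ^ 2) :=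
    (integrable_indicator_iff measurableSet_closedBall).2
      (integrableOn_const (isCompact_closedBall _ _).measure_lt_top.ne)
  refine Integrable.mono (((hI.add hB).const_mul 2).integrableOn (s := {(0 : R2)}ᶜ)) ?_ ?_
  · have hm : Measurable fun x : R2 => ‖(W' (log ‖x‖) / ‖x‖ ^ 2) • x + gradient ψ₀ x‖ ^ 2 := by
      have := hW'c.measurable
      have := hc0.measurable
      fun_prop
    refine hm.aestronglyMeasurable.congr ?_
    filter_upwards [ae_restrict_mem (measurableSet_singleton (0 : R2)).compl] with x hx
    rw [hgr x hx]
  · refine (ae_restrict_iff' (measurableSet_singleton (0 : R2)).compl).2 ?_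
    filter_upwards [ae_norm_ne 1] with x hx1 hx
    rw [Real.norm_of_nonneg (by positivity), hgr x hx, Pi.add_apply]
    refine le_trans ?_ (le_abs_self _)
    rcases hx1.lt_or_gt with h | h
    · have hl : ¬ 0 ≤ log ‖x‖ := (log_neg (norm_pos_iff.2 hx) h).not_ge
      have hxb : x ∈ closedBall (0 : R2) 1 := by simpa using h.le
      rw [Set.indicator_of_mem hxb, if_neg hl, mul_zero, add_zero, ← hnorm _ x hx]
      have h2 := hM x hxb
      have h3 := norm_nonneg (gradient ψ₀ x)
      have h4 := norm_add_le ((W' (log ‖x‖) / ‖x‖ ^ 2) • x) (gradient ψ₀ x)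
      have h5 := norm_nonneg ((W' (log ‖x‖) / ‖x‖ ^ 2) • x + gradient ψ₀ x)
      generalize ‖(W' (log ‖x‖) / ‖x‖ ^ 2) • x + gradient ψ₀ x‖ = u at *
      generalize ‖(W' (log ‖x‖) / ‖x‖ ^ 2) • x‖ = v at *
      generalize ‖gradient ψ₀ x‖ = w at *
      nlinarith [sq_nonneg (v - w)]
    · have hxb : x ∉ closedBall (0 : R2) 1 := by simpa using h
      rw [Set.indicator_of_notMem hxb, add_zero, hgr0 x h, if_pos (log_pos h).le, mul_one,
        ← add_smul, ← add_div, hnorm _ x hx]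
      have : 0 ≤ (W' (log ‖x‖) + 2 * β) ^ 2 / ‖x‖ ^ 2 := by positivity
      linarith

theorem integrable_of_integrableOn_norm_le_one {f g h : R2 → ℝ}
    (hg : IntegrableOn g {x : R2 | ‖x‖ ≤ 1}) (hh : IntegrableOn h {x : R2 | 1 ≤ ‖x‖})
    (hfg : ∀ x : R2, 0 < ‖x‖ → ‖x‖ ≤ 1 → g x = f x) (hfh : ∀ x : R2, 1 ≤ ‖x‖ → h x = f x) :
    Integrable f := by
  have hs1 : MeasurableSet {x : R2 | ‖x‖ ≤ 1} := measurableSet_le measurable_norm measurable_const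
  have hs2 : MeasurableSet {x : R2 | 1 ≤ ‖x‖} := measurableSet_le measurable_const measurable_norm
  have h1 : IntegrableOn f {x : R2 | ‖x‖ ≤ 1} := by
    refine Integrable.congr hg ((ae_restrict_iff' hs1).2 ?_)
    filter_upwards [ae_norm_ne 0] with x hx0 hx
    exact hfg x (lt_of_le_of_ne (norm_nonneg x) hx0.symm) hx
  have h2 := h1.union (hh.congr_fun (fun x hx => hfh x hx) hs2)
  rw [← integrableOn_univ]
  exact h2.mono_set fun x _ => le_total ‖x‖ 1

theorem integrable_posPart_mul_exp {V : R2 → ℝ} {β δ : ℝ}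
    (h1 : IntegrableOn (fun x : R2 => max (V x) 0 * ‖x‖ ^ (-β - δ)) {x : R2 | ‖x‖ ≤ 1})
    (h2 : IntegrableOn (fun x : R2 => max (V x) 0 * ‖x‖ ^ (-β + δ)) {x : R2 | 1 ≤ ‖x‖}) :
    Integrable fun x => max (V x) 0 * exp (-β * log ‖x‖ + δ * |log ‖x‖|) := by
  refine integrable_of_integrableOn_norm_le_one h1 h2 (fun x hx0 hx => ?_) (fun x hx => ?_)
  · rw [rpow_def_of_pos hx0, abs_of_nonpos (log_nonpos hx0.le hx)]
    ring_nf
  · rw [rpow_def_of_pos (one_pos.trans_le hx), abs_of_nonneg (log_nonneg hx)]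
    ring_nf

theorem integrable_negPart_mul_exp {V : R2 → ℝ} {β : ℝ} (hV : LocallyIntegrable V)
    (h : IntegrableOn (fun x : R2 => max (-V x) 0 * ‖x‖ ^ (-(2 * β))) {x : R2 | 1 ≤ ‖x‖}) :
    Integrable fun x => max (-V x) 0 * exp (-(2 * β) * max (log ‖x‖) 0) := by
  have h1 : IntegrableOn (fun x => max (-V x) 0) {x : R2 | ‖x‖ ≤ 1} := by
    have h2 := hV.integrableOn_isCompact (isCompact_closedBall (0 : R2) 1)
    have h3 : closedBall (0 : R2) 1 = {x : R2 | ‖x‖ ≤ 1} := by ext; simp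
    rw [h3] at h2
    exact h2.neg.pos_part
  refine integrable_of_integrableOn_norm_le_one h1 h (fun x hx0 hx => ?_) (fun x hx => ?_)
  · rw [max_eq_right (log_nonpos hx0.le hx), mul_zero, exp_zero, mul_one]
  · rw [rpow_def_of_pos (one_pos.trans_le hx), max_eq_left (log_nonneg hx)]
    ring_nf

theorem ae_log_norm_ne (t : ℝ) : ∀ᵐ x : R2, log ‖x‖ ≠ t := by
  filter_upwards [ae_norm_ne 0, ae_norm_ne (exp t)] with x h0 hx h
  exact hx (by rw [← h, exp_log (lt_of_le_of_ne (norm_nonneg x) h0.symm)])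

theorem volume_annulus_ne_zero {a b : ℝ} (hab : a < b) :
    volume {x : R2 | a < log ‖x‖ ∧ log ‖x‖ < b} ≠ 0 := by
  have ho : IsOpen {x : R2 | exp a < ‖x‖ ∧ ‖x‖ < exp b} :=
    (isOpen_lt continuous_const continuous_norm).inter (isOpen_lt continuous_norm continuous_const)
  obtain ⟨x, hx⟩ := exists_norm_eq R2 (exp_pos ((a + b) / 2)).le
  have hne : {x : R2 | exp a < ‖x‖ ∧ ‖x‖ < exp b}.Nonempty :=
    ⟨x, by simp only [Set.mem_ofPred_eq, hx, exp_lt_exp]; constructor <;> linarith⟩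
  refine ((ho.measure_pos volume hne).trans_le (measure_mono fun y hy => ?_)).ne'
  have hy0 := (exp_pos a).trans hy.1
  exact ⟨(lt_log_iff_exp_lt hy0).2 hy.1, (log_lt_iff_lt_exp hy0).2 hy.2⟩

/-- Theorem 1.1, part (1): existence of a radially symmetric solution to the
Liouville equation for β > 0. -/
theorem existence_beta_pos (β : ℝ) (hβ : 0 < β) (V : R2 → ℝ)
    (hVloc : LocallyIntegrable V) (hVrad : RadSym V)
    (C R₁ R₂ : ℝ) (hC : 0 < C) (hR₁ : 0 < R₁) (hR : R₁ < R₂)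
    (hVC : ∀ᵐ x : R2, R₁ < ‖x‖ ∧ ‖x‖ < R₂ → C ≤ V x)
    (hVneg : IntegrableOn (fun x : R2 => max (-V x) 0 * ‖x‖ ^ (-(2*β)))
      {x : R2 | 1 ≤ ‖x‖})
    (δ : ℝ) (hδ : 0 < δ)
    (hVpos1 : IntegrableOn (fun x : R2 => max (V x) 0 * ‖x‖ ^ (-β - δ))
      {x : R2 | ‖x‖ ≤ 1})
    (hVpos2 : IntegrableOn (fun x : R2 => max (V x) 0 * ‖x‖ ^ (-β + δ))
      {x : R2 | 1 ≤ ‖x‖}) :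
    ∃ ψ : R2 → ℝ, LocallyIntegrable ψ ∧ RadSym ψ ∧ ContDiffOn ℝ 1 ψ {(0:R2)}ᶜ ∧
      IsWeakSol ψ (fun x => 4 * π * β * V x * Real.exp (ψ x)) ∧
      Integrable (fun x : R2 => |V x| * Real.exp (ψ x)) ∧
      (∫ x : R2, V x * Real.exp (ψ x)) = 1 ∧
      (∀ ψ₀ : R2 → ℝ, ContDiff ℝ (⊤ : ℕ∞) ψ₀ → RadSym ψ₀ →
        (∀ x : R2, 1 ≤ ‖x‖ → ψ₀ x = 2 * β * Real.log ‖x‖) →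
        IntegrableOn (fun x : R2 => ‖gradient ψ x + gradient ψ₀ x‖ ^ 2) {(0:R2)}ᶜ) ∧
      Tendsto (fun x : R2 => ψ x / Real.log ‖x‖) (cobounded R2) (nhds (-(2*β))) := by
  have hT : Measurable fun x : R2 => log ‖x‖ := by fun_prop
  have hab : log R₁ < log R₂ := log_lt_log hR₁ hR
  have hVab : ∀ᵐ x : R2, log R₁ < log ‖x‖ → log ‖x‖ < log R₂ → 0 < V x := by
    filter_upwards [hVC, ae_norm_ne 0] with x hx h0 h1 h2
    have hx0 := lt_of_le_of_ne (norm_nonneg x) h0.symm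
    exact hC.trans_le (hx ⟨(log_lt_log_iff hR₁ hx0).1 h1,
      (log_lt_log_iff hx0 (hR₁.trans hR)).1 h2⟩)
  obtain ⟨f, c, W, hWf, hq, hq1, hWq⟩ := exists_normalized_profile hβ hδ
    hVloc.aestronglyMeasurable hT.aemeasurable (integrable_posPart_mul_exp hVpos1 hVpos2)
    (integrable_negPart_mul_exp hVloc hVneg) hab hVab (volume_annulus_ne_zero hab)
  set q : R2 → ℝ := fun x => V x * exp (W (log ‖x‖)) with hqdef
  set D : ℝ → ℝ := fun t => ∫ x : R2, (max (t - log ‖x‖) 0 - max (-log ‖x‖) 0) * q x with hD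
  have hqrad : RadSym q := fun x y hxy => by simp only [hqdef, hVrad x y hxy, hxy]
  have hD' : ∀ t, HasDerivAt D (∫ x : R2, (if log ‖x‖ ≤ t then 1 else 0) * q x) t :=
    hasDerivAt_logPotential hT hq ae_log_norm_ne
  have hD'c := continuous_integral_ite_mul hT hq ae_log_norm_ne
  have hW' : ∀ t, HasDerivAt W (-(2 * β * ∫ x : R2, (if log ‖x‖ ≤ t then 1 else 0) * q x)) t :=
    fun t => (((hD' t).const_mul (2 * β)).const_sub c).congr_of_eventuallyEq
      (Eventually.of_forall hWq)
  have hW'c : Continuous fun t => -(2 * β * ∫ x : R2, (if log ‖x‖ ≤ t then 1 else 0) * q x) :=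
    (hD'c.const_mul (2 * β)).neg
  have hWc : ContDiff ℝ 1 W := by
    rw [contDiff_one_iff_deriv]
    refine ⟨fun t => (hW' t).differentiableAt, ?_⟩
    rwa [funext fun t => (hW' t).deriv]
  have hDloc : LocallyIntegrable fun x : R2 => D (log ‖x‖) := by
    have hDc : Continuous D := continuous_iff_continuousAt.2 fun t => (hD' t).continuousAt
    refine locallyIntegrable_logPotential hDc (M := ∫ x : R2, |q x|) fun t => ?_
    rw [mul_comm, ← integral_const_mul, ← Real.norm_eq_abs]
    refine norm_integral_le_of_norm_le (hq.abs.const_mul _) (ae_of_all _ fun x => ?_)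
    rw [norm_mul]
    exact mul_le_mul_of_nonneg_right (abs_max_sub_sub_max_neg_le t _) (norm_nonneg _)
  refine ⟨fun x => W (log ‖x‖), ?_, fun x y hxy => by simp only [hxy],
    contDiffOn_comp_log_norm hWc, ?_, ?_, hq1, fun ψ₀ hψ₀ _ hψ₀l => ?_, ?_⟩
  · have h := (locallyIntegrable_const c).sub (hDloc.smul (2 * β))
    refine h.congr (ae_of_all _ fun x => ?_)
    exact (hWq _).symm
  · have h := isWeakSol_of_eq_logPotential (ψ := fun x => W (log ‖x‖)) hq hqrad
      (fun x => hWq _) hDloc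
    simpa only [hqdef, mul_assoc] using h
  · simpa only [hqdef, abs_mul, abs_exp] using hq.abs
  · exact integrableOn_norm_sq_gradient_add hW' hW'c
      (integrable_sq_deriv_of_eq_primitive hWf hW') hψ₀ hψ₀l
  · have hl : Tendsto (fun x : R2 => log ‖x‖) (cobounded R2) atTop :=
      tendsto_log_atTop.comp tendsto_norm_cobounded_atTop
    have h1 : Tendsto (fun t => c / t - 2 * β * (D t / t)) atTop (𝓝 (0 - 2 * β * 1)) := by
      have := tendsto_logPotential_div hT.aemeasurable hq
      rw [hq1] at this
      exact (tendsto_const_nhds.div_atTop tendsto_id).sub (this.const_mul _)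
    rw [zero_sub, mul_one] at h1
    refine (h1.comp hl).congr fun x => ?_
    simp only [Function.comp_apply]
    rw [hWq, sub_div, mul_div_assoc]
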